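/- arXiv:2511.19714 — 3 statements merged into one kernel-verified Lean document; each statement's English description precedes it below -/
import Mathlib

section
/- For every k ≥ 1, the weighted norm of the successive differences is nonincreasing: ‖y_{k+1} − y_k‖_Ω² + (1/ρ)·‖v_{k+1} − v_k‖² ≤ ‖y_k − y_{k−1}‖_Ω² + (1/ρ)·‖v_k − v_{k−1}‖². -/
open scoped RealInnerProductSpace

section

variable {E : Type*} [NormedAddCommGroup E] [InnerProductSpace ℝ E]

/-- Subgradients of a function are monotone. -/
theorem inner_sub_nonneg_of_subgradient {G : E → ℝ} {x x' g g' : E}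
    (hg : ∀ z, G x + ⟪g, z - x⟫ ≤ G z) (hg' : ∀ z, G x' + ⟪g', z - x'⟫ ≤ G z) :
    0 ≤ ⟪g' - g, x' - x⟫ := by
  have h₁ := hg x'
  have h₂ := hg' x
  rw [← neg_sub x' x, inner_neg_right] at h₂
  rw [inner_sub_left]
  linarith

/-- If `S` is a symmetric square root of `W`, then `‖ρ S u‖² / ρ = ρ ⟪u, W u⟫`. -/
theorem one_div_mul_norm_smul_sq {W S : E →ₗ[ℝ] E} (hS : ∀ u w, ⟪S u, w⟫ = ⟪u, S w⟫)
    (hSS : ∀ u, S (S u) = W u) {ρ : ℝ} (hρ : 0 < ρ) (u : E) :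
    (1 / ρ) * ‖ρ • S u‖ ^ 2 = ρ * ⟪u, W u⟫ := by
  rw [norm_smul, mul_pow, ← real_inner_self_eq_norm_sq (S u), hS, hSS, Real.norm_eq_abs, sq_abs]
  field_simp

/-- Descent of the weighted successive differences, where `a`, `b`, `c` are three consecutive
primal iterates and the hypothesis `h` comes from comparing two consecutive optimality
conditions. -/
theorem inner_add_le_of_inner_nonneg {W Ω : E →ₗ[ℝ] E} (hW : ∀ u w, ⟪W u, w⟫ = ⟪u, W w⟫)
    (hW₀ : ∀ u, 0 ≤ ⟪u, W u⟫) {η ρ : ℝ} (hρ : 0 ≤ ρ) (hΩ : ∀ u, Ω u = η • u - ρ • W u)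
    (hΩ₀ : ∀ u, 0 ≤ ⟪u, Ω u⟫) {a b c : E}
    (h : 0 ≤ ⟪Ω (b - a) - η • (c - b) - ρ • W b, c - b⟫) :
    ⟪c - b, Ω (c - b)⟫ + ρ * ⟪c, W c⟫ ≤ ⟪b - a, Ω (b - a)⟫ + ρ * ⟪b, W b⟫ := by
  obtain ⟨d, rfl⟩ : ∃ d, c = b + d := ⟨c - b, by abel⟩
  obtain ⟨e, he⟩ : ∃ e, e = b - a := ⟨_, rfl⟩
  rw [← he] at h ⊢
  simp only [add_sub_cancel_left] at h ⊢
  have hsq := hΩ₀ (e - d)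
  have hd := mul_nonneg hρ (hW₀ d)
  have hde : ⟪d, W e⟫ = ⟪e, W d⟫ := by rw [← hW, real_inner_comm]
  have hbd : ⟪d, W b⟫ = ⟪b, W d⟫ := by rw [← hW, real_inner_comm]
  simp only [hΩ, map_sub, map_add, inner_sub_left, inner_sub_right, inner_add_left,
    inner_add_right, real_inner_smul_left, real_inner_smul_right, hW, hde, hbd,
    real_inner_comm e d] at h hsq ⊢
  linarith

end

/-- CONTEXT: consensus optimization in ℝ^N with linearized method of multipliers. -/
theorem stmt_2
    {N : ℕ} (hN : 1 ≤ N)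
    (W S : EuclideanSpace ℝ (Fin N) →ₗ[ℝ] EuclideanSpace ℝ (Fin N))
    (hWsymm : ∀ u w : EuclideanSpace ℝ (Fin N), ⟪W u, w⟫ = ⟪u, W w⟫)
    (hWpsd : ∀ u : EuclideanSpace ℝ (Fin N), 0 ≤ ⟪u, W u⟫)
    (hSsymm : ∀ u w : EuclideanSpace ℝ (Fin N), ⟪S u, w⟫ = ⟪u, S w⟫)
    (hSpsd : ∀ u : EuclideanSpace ℝ (Fin N), 0 ≤ ⟪u, S u⟫)
    (hSS : ∀ u : EuclideanSpace ℝ (Fin N), S (S u) = W u)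
    {η ρ : ℝ} (hη : 0 < η) (hρ : 0 < ρ)
    (Ω : EuclideanSpace ℝ (Fin N) →ₗ[ℝ] EuclideanSpace ℝ (Fin N))
    (hΩdef : ∀ u : EuclideanSpace ℝ (Fin N), Ω u = η • u - ρ • W u)
    (hΩpd : ∀ u : EuclideanSpace ℝ (Fin N), u ≠ 0 → 0 < ⟪u, Ω u⟫)
    (Y : Set (EuclideanSpace ℝ (Fin N))) (hYne : Y.Nonempty) (hYconv : Convex ℝ Y)
    (G : EuclideanSpace ℝ (Fin N) → ℝ) (hGconv : ConvexOn ℝ Set.univ G)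
    (y v : ℕ → EuclideanSpace ℝ (Fin N))
    (hyY : ∀ k : ℕ, y k ∈ Y)
    (hstep : ∀ k : ℕ, ∃ g : EuclideanSpace ℝ (Fin N),
      (∀ z : EuclideanSpace ℝ (Fin N), G (y (k+1)) + ⟪g, z - y (k+1)⟫ ≤ G z) ∧
      (∀ z ∈ Y, ⟪S (v k) - ρ • W (y k) - η • (y (k+1) - y k) - g, z - y (k+1)⟫ ≤ 0))
    (hv : ∀ k : ℕ, v (k+1) = v k - ρ • S (y (k+1)))
    :
    ∀ k : ℕ, 1 ≤ k →
      ⟪y (k+1) - y k, Ω (y (k+1) - y k)⟫ + (1/ρ) * ‖v (k+1) - v k‖^2 ≤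
        ⟪y k - y (k-1), Ω (y k - y (k-1))⟫ + (1/ρ) * ‖v k - v (k-1)‖^2 := by
  intro k hk
  obtain ⟨m, rfl⟩ := Nat.exists_eq_add_of_le' hk
  rw [Nat.add_sub_cancel]
  have hdual : ∀ j, (1 / ρ) * ‖v (j + 1) - v j‖ ^ 2 = ρ * ⟪y (j + 1), W (y (j + 1))⟫ := by
    intro j
    rw [hv, sub_sub_cancel_left, norm_neg, one_div_mul_norm_smul_sq hSsymm hSS hρ]
  have hΩnonneg : ∀ u, 0 ≤ ⟪u, Ω u⟫ := by
    intro u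
    obtain rfl | hu := eq_or_ne u 0
    · simp
    · exact (hΩpd u hu).le
  rw [hdual, hdual]
  refine inner_add_le_of_inner_nonneg hWsymm hWpsd hρ.le hΩdef hΩnonneg ?_
  obtain ⟨g, hg, hopt⟩ := hstep m
  obtain ⟨g', hg', hopt'⟩ := hstep (m + 1)
  have hmono := inner_sub_nonneg_of_subgradient hg hg'
  have h := hopt _ (hyY (m + 1 + 1))
  have h' := hopt' _ (hyY (m + 1))
  rw [← neg_sub (y (m + 1 + 1)), inner_neg_right, hv, map_sub, map_smul, hSS] at h'
  rw [hΩdef, map_sub]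
  simp only [inner_sub_left, smul_sub, real_inner_smul_left] at h h' hmono ⊢
  linarith
end

section
/- For every k ≥ 1 the consensus violation satisfies the non-ergodic rate ⟪y_{k+1}, W·y_{k+1}⟫ ≤ V_0/(ρ·k); equivalently ‖S·y_{k+1}‖ ≤ √(V_0/(ρ·k)). -/
open scoped RealInnerProductSpace

section

variable {E : Type*} [NormedAddCommGroup E] [InnerProductSpace ℝ E]

/-- Two relative subgradients `p` at `a` and `q` at `b` of the same function on `Y` satisfy the
monotonicity inequality. -/
theorem inner_sub_nonneg_of_subgradient_s7 {Y : Set E} {G : E → ℝ} {a b p q : E}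
    (ha : a ∈ Y) (hb : b ∈ Y)
    (hp : ∀ z ∈ Y, G a + ⟪p, z - a⟫ ≤ G z) (hq : ∀ z ∈ Y, G b + ⟪q, z - b⟫ ≤ G z) :
    0 ≤ ⟪p - q, a - b⟫ := by
  have h₁ := hp b hb
  have h₂ := hq a ha
  simp only [inner_sub_left, inner_sub_right] at *
  linarith

/-- A subgradient plus a normal vector to `Y` is a subgradient relative to `Y`. -/
theorem subgradient_of_normal {Y : Set E} {G : E → ℝ} {a p : E}
    (h : ∃ g : E, (∀ z, G a + ⟪g, z - a⟫ ≤ G z) ∧ ∀ z ∈ Y, ⟪p - g, z - a⟫ ≤ 0) :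
    ∀ z ∈ Y, G a + ⟪p, z - a⟫ ≤ G z := by
  obtain ⟨g, hg, hn⟩ := h
  intro z hz
  have h₁ := hg z
  have h₂ := hn z hz
  rw [inner_sub_left] at h₂
  linarith

/-- The energy `⟪u, Ω u⟫ + ‖w‖² / ρ` of the primal-dual pair `(u, w)`. -/
noncomputable def primalDualEnergy (Ω : E →ₗ[ℝ] E) (ρ : ℝ) (u w : E) : ℝ :=
  ⟪u, Ω u⟫ + (1 / ρ) * ‖w‖ ^ 2

/-- A proximal step for a monotone operator in the primal-dual metric decreases the energy. -/
theorem primalDualEnergy_add_le {Ω S : E →ₗ[ℝ] E} {ρ : ℝ} (hρ : 0 < ρ)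
    (hΩ : ∀ u w, ⟪Ω u, w⟫ = ⟪u, Ω w⟫) (hS : ∀ u w, ⟪S u, w⟫ = ⟪u, S w⟫)
    {a b e f : E} (hef : f - e = ρ • S a) (h : 0 ≤ ⟪S e - Ω (a - b), a⟫) :
    primalDualEnergy Ω ρ a e + primalDualEnergy Ω ρ (a - b) (e - f) ≤
      primalDualEnergy Ω ρ b f := by
  have hSe : ⟪S e, a⟫ = (1 / ρ) * ⟪e, f - e⟫ := by
    rw [hef, hS, inner_smul_right]
    field_simp
  have hba : ⟪b, Ω a⟫ = ⟪a, Ω b⟫ := by rw [← hΩ, real_inner_comm]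
  have hfe : ⟪f, e⟫ = ⟪e, f⟫ := real_inner_comm _ _
  rw [inner_sub_left, hSe, hΩ, inner_sub_left] at h
  simp only [primalDualEnergy, ← real_inner_self_eq_norm_sq, map_sub, inner_sub_left,
    inner_sub_right] at *
  rw [hba, hfe]
  rw [hba] at h
  linarith

/-- If `D` is antitone and `V` decreases by at least `D k` at step `k`, with `V` nonnegative,
then `D k ≤ V 0 / (k + 1)`. -/
theorem succ_mul_le_of_add_le {V D : ℕ → ℝ} (hV : ∀ k, 0 ≤ V k)
    (hVD : ∀ k, V (k + 1) + D k ≤ V k) (hD : ∀ k, D (k + 1) ≤ D k) (k : ℕ) :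
    ((k : ℝ) + 1) * D k ≤ V 0 := by
  have hsum : ∀ n : ℕ, V (n + 1) + ((n : ℝ) + 1) * D n ≤ V 0 := by
    intro n
    induction n with
    | zero => simpa using hVD 0
    | succ n ih =>
      have h₁ := hVD (n + 1)
      have h₂ := mul_le_mul_of_nonneg_left (hD n) (by positivity : (0 : ℝ) ≤ (n : ℝ) + 1)
      push_cast
      linarith
  linarith [hsum k, hV (k + 1)]

end

/-- CONTEXT: consensus optimization in ℝ^N with linearized method of multipliers. -/
theorem stmt_7
    {N : ℕ} (hN : 1 ≤ N)
    (W S : EuclideanSpace ℝ (Fin N) →ₗ[ℝ] EuclideanSpace ℝ (Fin N))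
    (hWsymm : ∀ u w : EuclideanSpace ℝ (Fin N), ⟪W u, w⟫ = ⟪u, W w⟫)
    (hWpsd : ∀ u : EuclideanSpace ℝ (Fin N), 0 ≤ ⟪u, W u⟫)
    (hSsymm : ∀ u w : EuclideanSpace ℝ (Fin N), ⟪S u, w⟫ = ⟪u, S w⟫)
    (hSpsd : ∀ u : EuclideanSpace ℝ (Fin N), 0 ≤ ⟪u, S u⟫)
    (hSS : ∀ u : EuclideanSpace ℝ (Fin N), S (S u) = W u)
    {η ρ : ℝ} (hη : 0 < η) (hρ : 0 < ρ)
    (Ω : EuclideanSpace ℝ (Fin N) →ₗ[ℝ] EuclideanSpace ℝ (Fin N))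
    (hΩdef : ∀ u : EuclideanSpace ℝ (Fin N), Ω u = η • u - ρ • W u)
    (hΩpd : ∀ u : EuclideanSpace ℝ (Fin N), u ≠ 0 → 0 < ⟪u, Ω u⟫)
    (Y : Set (EuclideanSpace ℝ (Fin N))) (hYne : Y.Nonempty) (hYconv : Convex ℝ Y)
    (G : EuclideanSpace ℝ (Fin N) → ℝ) (hGconv : ConvexOn ℝ Set.univ G)
    (y v : ℕ → EuclideanSpace ℝ (Fin N))
    (hyY : ∀ k : ℕ, y k ∈ Y)
    (hstep : ∀ k : ℕ, ∃ g : EuclideanSpace ℝ (Fin N),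
      (∀ z : EuclideanSpace ℝ (Fin N), G (y (k+1)) + ⟪g, z - y (k+1)⟫ ≤ G z) ∧
      (∀ z ∈ Y, ⟪S (v k) - ρ • W (y k) - η • (y (k+1) - y k) - g, z - y (k+1)⟫ ≤ 0))
    (hv : ∀ k : ℕ, v (k+1) = v k - ρ • S (y (k+1)))
    (ystar vstar : EuclideanSpace ℝ (Fin N))
    (hystarY : ystar ∈ Y) (hWystar : W ystar = 0)
    (hKKT : ∃ gstar : EuclideanSpace ℝ (Fin N),
      (∀ z : EuclideanSpace ℝ (Fin N), G ystar + ⟪gstar, z - ystar⟫ ≤ G z) ∧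
      (∀ z ∈ Y, ⟪S vstar - gstar, z - ystar⟫ ≤ 0))
    (V₀ : ℝ)
    (hV₀ : V₀ = ⟪y 0 - ystar, Ω (y 0 - ystar)⟫ + (1/ρ) * ‖v 0 - vstar‖^2) :
    ∀ k : ℕ, 1 ≤ k →
      ⟪y (k+1), W (y (k+1))⟫ ≤ V₀ / (ρ * (k : ℝ)) ∧
      ‖S (y (k+1))‖ ≤ Real.sqrt (V₀ / (ρ * (k : ℝ))) := by
  have hΩsymm : ∀ u w, ⟪Ω u, w⟫ = ⟪u, Ω w⟫ := by
    intro u w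
    simp only [hΩdef, inner_sub_left, inner_sub_right, real_inner_smul_left,
      real_inner_smul_right, hWsymm]
  have hΩnonneg : ∀ u, 0 ≤ ⟪u, Ω u⟫ := by
    intro u
    rcases eq_or_ne u 0 with rfl | hu
    · simp
    · exact (hΩpd u hu).le
  have hnorm : ∀ u, ‖S u‖ ^ 2 = ⟪u, W u⟫ := by
    intro u
    rw [← real_inner_self_eq_norm_sq, hSsymm, hSS]
  have hSystar : S ystar = 0 := by
    have h := hnorm ystar
    rw [hWystar, inner_zero_right] at h
    exact norm_eq_zero.1 (pow_eq_zero_iff two_ne_zero |>.1 h)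
  have henergy : ∀ u w, 0 ≤ primalDualEnergy Ω ρ u w := fun u w =>
    add_nonneg (hΩnonneg u) (by positivity)
  have hsub : ∀ k, ∀ z ∈ Y,
      G (y (k + 1)) + ⟪S (v (k + 1)) - Ω (y (k + 1) - y k), z - y (k + 1)⟫ ≤ G z := by
    intro k
    have hp : S (v (k + 1)) - Ω (y (k + 1) - y k) =
        S (v k) - ρ • W (y k) - η • (y (k + 1) - y k) := by
      rw [hv, hΩdef, map_sub, map_smul, hSS, map_sub, smul_sub ρ]
      abel
    rw [hp]
    exact subgradient_of_normal (hstep k)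
  have hsubstar := subgradient_of_normal hKKT
  have hdescent : ∀ k, primalDualEnergy Ω ρ (y (k + 1) - ystar) (v (k + 1) - vstar) +
      primalDualEnergy Ω ρ (y (k + 1) - y k) (v (k + 1) - v k) ≤
      primalDualEnergy Ω ρ (y k - ystar) (v k - vstar) := by
    intro k
    have hmono := inner_sub_nonneg_of_subgradient_s7 (hyY (k + 1)) hystarY (hsub k) hsubstar
    have h := primalDualEnergy_add_le (a := y (k + 1) - ystar) (b := y k - ystar)
      (e := v (k + 1) - vstar) (f := v k - vstar) hρ hΩsymm hSsymm
      (by rw [hv, map_sub, hSystar, sub_zero]; abel)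
      (by rw [sub_sub_sub_cancel_right, map_sub S, sub_right_comm]; exact hmono)
    rwa [sub_sub_sub_cancel_right, sub_sub_sub_cancel_right] at h
  have hantitone : ∀ k,
      primalDualEnergy Ω ρ (y (k + 1 + 1) - y (k + 1)) (v (k + 1 + 1) - v (k + 1)) ≤
      primalDualEnergy Ω ρ (y (k + 1) - y k) (v (k + 1) - v k) := by
    intro k
    have hmono := inner_sub_nonneg_of_subgradient_s7 (hyY (k + 1 + 1)) (hyY (k + 1))
      (hsub (k + 1)) (hsub k)
    refine (le_add_of_nonneg_right (henergy _ _)).trans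
      (primalDualEnergy_add_le hρ hΩsymm hSsymm ?_ ?_)
    · rw [hv (k + 1), hv k, map_sub, smul_sub]
      abel
    · rwa [map_sub S, map_sub Ω, sub_sub_sub_comm]
  intro k hk
  have hkpos : (0 : ℝ) < k := by exact_mod_cast hk
  have hrate := succ_mul_le_of_add_le
    (V := fun k => primalDualEnergy Ω ρ (y k - ystar) (v k - vstar))
    (fun k => henergy _ _) hdescent hantitone k
  have hresidual : ρ * ⟪y (k + 1), W (y (k + 1))⟫ ≤
      primalDualEnergy Ω ρ (y (k + 1) - y k) (v (k + 1) - v k) := by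
    have he : v (k + 1) - v k = -(ρ • S (y (k + 1))) := by
      rw [hv]
      abel
    have hdual : (1 / ρ) * ‖v (k + 1) - v k‖ ^ 2 = ρ * ⟪y (k + 1), W (y (k + 1))⟫ := by
      rw [he, norm_neg, norm_smul, mul_pow, hnorm, Real.norm_of_nonneg hρ.le]
      field_simp
    rw [primalDualEnergy, hdual]
    exact le_add_of_nonneg_left (hΩnonneg _)
  have hbound : ⟪y (k + 1), W (y (k + 1))⟫ ≤ V₀ / (ρ * (k : ℝ)) := by
    rw [le_div_iff₀ (by positivity), hV₀]
    have h₁ := mul_le_mul_of_nonneg_left hresidual hkpos.le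
    have h₂ := henergy (y (k + 1) - y k) (v (k + 1) - v k)
    change _ ≤ ⟪y 0 - ystar, Ω (y 0 - ystar)⟫ + (1 / ρ) * ‖v 0 - vstar‖ ^ 2 at hrate
    linarith
  exact ⟨hbound, Real.le_sqrt_of_sq_le ((hnorm _).trans_le hbound)⟩
end

section
/- For every k ≥ 1 the power-balance (coupling-constraint) violation satisfies the non-ergodic rate ‖Σ_i (x_{k+1,i} − d_i)‖ ≤ √(n·η)·√(V_0/k). -/
open scoped RealInnerProductSpace

section Convex

variable {E : Type*} [NormedAddCommGroup E] [InnerProductSpace ℝ E]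

lemma nonneg_of_forall_nonneg_add_mul {a b : ℝ}
    (h : ∀ t : ℝ, 0 < t → t ≤ 1 → 0 ≤ a + t * b) : 0 ≤ a := by
  have ht : Filter.Tendsto (fun t : ℝ => a + t * b) (nhdsWithin 0 (Set.Ioi 0)) (nhds a) := by
    have hc : Continuous fun t : ℝ => a + t * b := by fun_prop
    simpa using (hc.tendsto 0).mono_left nhdsWithin_le_nhds
  refine ge_of_tendsto ht ?_
  filter_upwards [Ioc_mem_nhdsGT (zero_lt_one' ℝ)] with t ht using h t ht.1 ht.2

/-- First-order optimality condition for a convex function plus a quadratic penalty. -/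
lemma ConvexOn.le_of_minimizes_add_sq {X : Set E} (hX : Convex ℝ X) {f : E → ℝ}
    (hf : ConvexOn ℝ Set.univ f) {η : ℝ} (hη : 0 < η) {c x g : E} (hx : x ∈ X)
    (hg : c + η⁻¹ • x = g)
    (hmin : ∀ ξ ∈ X, f x + η / 2 * ‖c + η⁻¹ • x‖ ^ 2 ≤ f ξ + η / 2 * ‖c + η⁻¹ • ξ‖ ^ 2)
    {ξ : E} (hξ : ξ ∈ X) : f x - ⟪g, ξ - x⟫ ≤ f ξ := by
  subst hg
  suffices h : 0 ≤ f ξ - f x + ⟪c + η⁻¹ • x, ξ - x⟫ by linarith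
  refine nonneg_of_forall_nonneg_add_mul (b := ‖ξ - x‖ ^ 2 / (2 * η)) fun t ht0 ht1 => ?_
  have hmem := hX hx hξ (sub_nonneg.2 ht1) ht0.le (by ring)
  have hconv := hf.2 (Set.mem_univ x) (Set.mem_univ ξ) (sub_nonneg.2 ht1) ht0.le (by ring)
  have hm := hmin _ hmem
  have heq : c + η⁻¹ • ((1 - t) • x + t • ξ) = (c + η⁻¹ • x) + (η⁻¹ * t) • (ξ - x) := by
    module
  rw [heq, norm_add_sq_real _ ((η⁻¹ * t) • _), inner_smul_right, norm_smul,
    mul_pow, Real.norm_eq_abs, sq_abs] at hm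
  simp only [smul_eq_mul] at hconv
  have hquad : η / 2 * (‖c + η⁻¹ • x‖ ^ 2 + 2 * (η⁻¹ * t * ⟪c + η⁻¹ • x, ξ - x⟫)
      + (η⁻¹ * t) ^ 2 * ‖ξ - x‖ ^ 2) = η / 2 * ‖c + η⁻¹ • x‖ ^ 2
      + t * (⟪c + η⁻¹ • x, ξ - x⟫ + t * (‖ξ - x‖ ^ 2 / (2 * η))) := by
    field_simp
    ring
  rw [hquad] at hm
  refine nonneg_of_mul_nonneg_right (a := t) ?_ ht0
  linarith

end Convex

/-- Non-ergodic rate of the residuals of a proximal-point sequence in a semi-inner product. -/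
lemma LinearMap.BilinForm.succ_mul_residual_le {H : Type*} [AddCommGroup H] [Module ℝ H]
    (Q : LinearMap.BilinForm ℝ H) (hsymm : ∀ a b, Q a b = Q b a) (hnonneg : ∀ a, 0 ≤ Q a a)
    (z : ℕ → H) (zstar : H)
    (hfix : ∀ k, Q (z (k + 1) - z k) (z (k + 1) - zstar) ≤ 0)
    (hmono : ∀ k, Q ((z (k + 2) - z (k + 1)) - (z (k + 1) - z k)) (z (k + 2) - z (k + 1)) ≤ 0)
    (k : ℕ) :
    ((k : ℝ) + 1) * Q (z (k + 1) - z k) (z (k + 1) - z k) ≤ Q (z 0 - zstar) (z 0 - zstar) := by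
  have hsq : ∀ a b : H, Q (a - b) (a - b) = Q a a - 2 * Q b a + Q b b := fun a b => by
    simp only [map_sub, LinearMap.sub_apply, hsymm a b]
    ring
  have hdescent : ∀ k, Q (z (k + 1) - z k) (z (k + 1) - z k)
      + Q (z (k + 1) - zstar) (z (k + 1) - zstar) ≤ Q (z k - zstar) (z k - zstar) := fun k => by
    have h := hsq (z (k + 1) - zstar) (z (k + 1) - z k)
    rw [sub_sub_sub_cancel_left] at h
    linarith [hfix k]
  have hanti : ∀ k, Q (z (k + 2) - z (k + 1)) (z (k + 2) - z (k + 1))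
      ≤ Q (z (k + 1) - z k) (z (k + 1) - z k) := fun k => by
    have h := hsq (z (k + 2) - z (k + 1)) ((z (k + 2) - z (k + 1)) - (z (k + 1) - z k))
    rw [sub_sub_cancel] at h
    linarith [hmono k, hnonneg ((z (k + 2) - z (k + 1)) - (z (k + 1) - z k))]
  have hsum : ((k : ℝ) + 1) * Q (z (k + 1) - z k) (z (k + 1) - z k)
      + Q (z (k + 1) - zstar) (z (k + 1) - zstar) ≤ Q (z 0 - zstar) (z 0 - zstar) := by
    induction k with
    | zero => simpa using hdescent 0
    | succ k ih =>
      have h := mul_le_mul_of_nonneg_left (hanti k) (by positivity : (0 : ℝ) ≤ k + 1)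
      have h' := hdescent (k + 1)
      push_cast
      linarith
  linarith [hnonneg (z (k + 1) - zstar)]

section Tuples

variable {ι E : Type*} [Fintype ι] [NormedAddCommGroup E] [InnerProductSpace ℝ E]

/-- The inner product `∑ i, ⟪u i, w i⟫` of tuples, as a bilinear form. -/
noncomputable def tupleInner (ι E : Type*) [Fintype ι] [NormedAddCommGroup E]
    [InnerProductSpace ℝ E] : LinearMap.BilinForm ℝ (ι → E) :=
  ∑ i, (innerₗ E).compl₁₂ (LinearMap.proj i) (LinearMap.proj i)

lemma tupleInner_apply (u w : ι → E) : tupleInner ι E u w = ∑ i, ⟪u i, w i⟫ := by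
  simp [tupleInner, LinearMap.sum_apply]

lemma tupleInner_comm (u w : ι → E) : tupleInner ι E u w = tupleInner ι E w u := by
  simp only [tupleInner_apply, real_inner_comm]

lemma tupleInner_self (u : ι → E) : tupleInner ι E u u = ∑ i, ‖u i‖ ^ 2 := by
  simp only [tupleInner_apply, real_inner_self_eq_norm_sq]

lemma tupleInner_self_nonneg (u : ι → E) : 0 ≤ tupleInner ι E u u := by
  rw [tupleInner_self]
  positivity

lemma tupleInner_const (u : ι → E) (w : E) :
    tupleInner ι E u (fun _ => w) = ⟪∑ i, u i, w⟫ := by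
  rw [tupleInner_apply, sum_inner]

/-- The action of a matrix on tuples of vectors. -/
noncomputable def tupleMul (E : Type*) [NormedAddCommGroup E] [InnerProductSpace ℝ E]
    (A : Matrix ι ι ℝ) : (ι → E) →ₗ[ℝ] (ι → E) :=
  LinearMap.pi fun i => ∑ j, A i j • LinearMap.proj j

lemma tupleMul_apply (A : Matrix ι ι ℝ) (u : ι → E) (i : ι) :
    tupleMul E A u i = ∑ j, A i j • u j := by
  simp [tupleMul, LinearMap.sum_apply]

lemma tupleMul_tupleMul (A B : Matrix ι ι ℝ) (u : ι → E) :
    tupleMul E A (tupleMul E B u) = tupleMul E (A * B) u := by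
  ext1 i
  simp only [tupleMul_apply, Matrix.mul_apply, Finset.smul_sum, Finset.sum_smul, smul_smul]
  exact Finset.sum_comm

lemma tupleInner_tupleMul {A : Matrix ι ι ℝ} (hA : A.IsSymm) (u w : ι → E) :
    tupleInner ι E (tupleMul E A u) w = tupleInner ι E u (tupleMul E A w) := by
  simp only [tupleInner_apply, tupleMul_apply, sum_inner, inner_sum, inner_smul_left,
    inner_smul_right, RCLike.conj_to_real]
  rw [Finset.sum_comm]
  simp only [hA.apply]

lemma tupleMul_const {A : Matrix ι ι ℝ} (hA : ∀ i, ∑ j, A i j = 0) (w : E) :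
    tupleMul E A (fun _ => w) = 0 := by
  ext1 i
  simp [tupleMul_apply, ← Finset.sum_smul, hA]

lemma sum_tupleMul {A : Matrix ι ι ℝ} (hA : A.IsSymm) (hrow : ∀ i, ∑ j, A i j = 0)
    (u : ι → E) : ∑ i, tupleMul E A u i = 0 := by
  refine ext_inner_right ℝ fun w => ?_
  rw [← tupleInner_const, tupleInner_tupleMul hA, tupleMul_const hrow, map_zero, inner_zero_left]

lemma Matrix.IsSymm.row_sum_eq_zero_of_sq {M : Matrix ι ι ℝ} (hM : M.IsSymm)
    (hrow : ∀ i, ∑ j, (M * M) i j = 0) (i : ι) : ∑ j, M i j = 0 := by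
  have h := tupleInner_tupleMul (E := ℝ) hM (fun _ => 1) (tupleMul ℝ M fun _ => 1)
  rw [tupleMul_tupleMul, tupleMul_const hrow, map_zero, tupleInner_self,
    Finset.sum_eq_zero_iff_of_nonneg fun _ _ => by positivity] at h
  simpa [tupleMul_apply] using h i (Finset.mem_univ i)

/-- The sum of a tuple is controlled by any semi-inner product in which constant tuples are
eigenvectors. -/
lemma mul_norm_sum_sq_le [Nonempty ι] (P : LinearMap.BilinForm ℝ (ι → E))
    (hsymm : ∀ a b, P a b = P b a) (hnonneg : ∀ a, 0 ≤ P a a) {η : ℝ}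
    (hconst : ∀ (u : ι → E) (w : E), P u (fun _ => w) = η * ⟪∑ i, u i, w⟫) (u : ι → E) :
    η * ‖∑ i, u i‖ ^ 2 ≤ Fintype.card ι * P u u := by
  have hn : (0 : ℝ) < Fintype.card ι := by exact_mod_cast Fintype.card_pos
  set w := ∑ i, u i with hw
  have h := hnonneg ((Fintype.card ι : ℝ) • u - fun _ => w)
  have hu : P u (fun _ => w) = η * ‖w‖ ^ 2 := by rw [hconst, real_inner_self_eq_norm_sq]
  have hww : P (fun _ => w) (fun _ => w) = Fintype.card ι * (η * ‖w‖ ^ 2) := by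
    rw [hconst, Finset.sum_const, Finset.card_univ, ← Nat.cast_smul_eq_nsmul ℝ, inner_smul_left,
      real_inner_self_eq_norm_sq, RCLike.conj_to_real]
    ring
  simp only [map_sub, map_smul, LinearMap.sub_apply, LinearMap.smul_apply, smul_eq_mul,
    hsymm (fun _ => w) u, hu, hww] at h
  refine le_of_mul_le_mul_left (a := (Fintype.card ι : ℝ)) ?_ hn
  linarith

end Tuples

/-- CONTEXT: economic dispatch via dual consensus; E = ℝ^p, variables in Eⁿ. -/
theorem stmt_10
    {n p : ℕ} (hn : 1 ≤ n) (hp : 1 ≤ p)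
    (L M : Matrix (Fin n) (Fin n) ℝ)
    (hLsymm : L.IsSymm)
    (hLpsd : ∀ c : Fin n → ℝ, 0 ≤ ∑ i, ∑ j, c i * L i j * c j)
    (hLrow : ∀ i : Fin n, ∑ j, L i j = 0)
    (hMsymm : M.IsSymm)
    (hMpsd : ∀ c : Fin n → ℝ, 0 ≤ ∑ i, ∑ j, c i * M i j * c j)
    (hMM : M * M = L)
    (W S : (Fin n → EuclideanSpace ℝ (Fin p)) → (Fin n → EuclideanSpace ℝ (Fin p)))
    (hW : ∀ (u : Fin n → EuclideanSpace ℝ (Fin p)) (i : Fin n), W u i = ∑ j, L i j • u j)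
    (hS : ∀ (u : Fin n → EuclideanSpace ℝ (Fin p)) (i : Fin n), S u i = ∑ j, M i j • u j)
    {η ρ : ℝ} (hη : 0 < η) (hρ : 0 < ρ)
    (Ω : (Fin n → EuclideanSpace ℝ (Fin p)) → (Fin n → EuclideanSpace ℝ (Fin p)))
    (hΩdef : ∀ u : Fin n → EuclideanSpace ℝ (Fin p), Ω u = η • u - ρ • W u)
    (hΩpd : ∀ u : Fin n → EuclideanSpace ℝ (Fin p), u ≠ 0 → 0 < ∑ i, ⟪u i, Ω u i⟫)
    (X : Fin n → Set (EuclideanSpace ℝ (Fin p)))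
    (hXne : ∀ i, (X i).Nonempty) (hXcl : ∀ i, IsClosed (X i)) (hXconv : ∀ i, Convex ℝ (X i))
    (f : Fin n → EuclideanSpace ℝ (Fin p) → ℝ)
    (hfconv : ∀ i, ConvexOn ℝ Set.univ (f i))
    (d : Fin n → EuclideanSpace ℝ (Fin p))
    (x y v : ℕ → Fin n → EuclideanSpace ℝ (Fin p))
    (hxX : ∀ (k : ℕ) (i : Fin n), x (k+1) i ∈ X i)
    (hstep : ∀ (k : ℕ) (i : Fin n), ∀ ξ ∈ X i,
      f i (x (k+1) i)
          + (η/2) * ‖y k i + η⁻¹ • (x (k+1) i - d i + S (v k) i - ρ • W (y k) i)‖^2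
        ≤ f i ξ + (η/2) * ‖y k i + η⁻¹ • (ξ - d i + S (v k) i - ρ • W (y k) i)‖^2)
    (hy : ∀ k : ℕ, y (k+1) = y k + η⁻¹ • (x (k+1) - d + S (v k) - ρ • W (y k)))
    (hv : ∀ k : ℕ, v (k+1) = v k - ρ • S (y (k+1)))
    (xstar : Fin n → EuclideanSpace ℝ (Fin p)) (δstar : EuclideanSpace ℝ (Fin p))
    (hxstarX : ∀ i, xstar i ∈ X i)
    (hbal : ∑ i, (xstar i - d i) = 0)
    (ystar : Fin n → EuclideanSpace ℝ (Fin p)) (hystar : ystar = fun _ => δstar)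
    (hsaddle : ∀ x' : Fin n → EuclideanSpace ℝ (Fin p), (∀ i, x' i ∈ X i) →
      (∑ i, f i (xstar i)) - ∑ i, ⟪ystar i, x' i - xstar i⟫ ≤ ∑ i, f i (x' i))
    (vstar : Fin n → EuclideanSpace ℝ (Fin p)) (hvstar : S vstar = d - xstar)
    (V₀ : ℝ)
    (hV₀ : V₀ = (∑ i, ⟪(y 0 - ystar) i, Ω (y 0 - ystar) i⟫) + (1/ρ) * ∑ i, ‖v 0 i - vstar i‖^2)
    :
    ∀ k : ℕ, 1 ≤ k →
      ‖∑ i, (x (k+1) i - d i)‖ ≤ Real.sqrt ((n : ℝ) * η) * Real.sqrt (V₀ / (k : ℝ)) := by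
  intro k hk
  have : Nonempty (Fin n) := ⟨⟨0, hn⟩⟩
  set B := tupleInner (Fin n) (EuclideanSpace ℝ (Fin p))
  obtain rfl : W = tupleMul (EuclideanSpace ℝ (Fin p)) L :=
    funext fun u => funext fun i => by rw [hW, tupleMul_apply]
  obtain rfl : S = tupleMul (EuclideanSpace ℝ (Fin p)) M :=
    funext fun u => funext fun i => by rw [hS, tupleMul_apply]
  set S := tupleMul (EuclideanSpace ℝ (Fin p)) M
  set W := tupleMul (EuclideanSpace ℝ (Fin p)) L
  have hMrow : ∀ i, ∑ j, M i j = 0 := hMsymm.row_sum_eq_zero_of_sq (by rwa [hMM])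
  have hSS : ∀ u, S (S u) = W u := fun u => by rw [tupleMul_tupleMul, hMM]
  obtain ⟨O, rfl⟩ : ∃ O : (Fin n → EuclideanSpace ℝ (Fin p)) →ₗ[ℝ]
      (Fin n → EuclideanSpace ℝ (Fin p)), Ω = O :=
    ⟨η • LinearMap.id - ρ • W, funext fun u => by simp [hΩdef]⟩
  have hPsymm : ∀ a b, B.compl₂ O a b = B.compl₂ O b a := fun a b => by
    simp only [LinearMap.compl₂_apply, hΩdef, map_sub, map_smul]
    rw [tupleInner_comm a b, ← tupleInner_tupleMul hLsymm, tupleInner_comm (W a)]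
  have hPnonneg : ∀ a, 0 ≤ B.compl₂ O a a := fun a => by
    rcases eq_or_ne a 0 with rfl | ha
    · simp
    · rw [LinearMap.compl₂_apply, tupleInner_apply]
      exact (hΩpd a ha).le
  have hPconst : ∀ (u : Fin n → EuclideanSpace ℝ (Fin p)) (w : EuclideanSpace ℝ (Fin p)),
      B.compl₂ O u (fun _ => w) = η * ⟪∑ i, u i, w⟫ :=
    fun u w => by
      rw [LinearMap.compl₂_apply, hΩdef, tupleMul_const hLrow, smul_zero, sub_zero, map_smul,
        tupleInner_const, smul_eq_mul]
  let Q : LinearMap.BilinForm ℝ ((Fin n → EuclideanSpace ℝ (Fin p)) ×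
      (Fin n → EuclideanSpace ℝ (Fin p))) :=
    (B.compl₂ O).compl₁₂ (LinearMap.fst ℝ _ _) (LinearMap.fst ℝ _ _)
      + (1 / ρ) • B.compl₁₂ (LinearMap.snd ℝ _ _) (LinearMap.snd ℝ _ _)
  have hQ : ∀ a b, Q a b = B.compl₂ O a.1 b.1 + (1 / ρ) * B a.2 b.2 := fun a b => rfl
  have hOy : ∀ k, O (y (k + 1) - y k) = x (k + 1) - d + S (v (k + 1)) := fun k => by
    have h : η • (y (k + 1) - y k) = x (k + 1) - d + S (v k) - ρ • W (y k) := by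
      rw [hy k, add_sub_cancel_left, smul_inv_smul₀ hη.ne']
    rw [hΩdef, h, hv k]
    simp only [map_sub, map_smul, hSS]
    module
  have hsub : ∀ (k : ℕ) (i : Fin n), ∀ ξ ∈ X i,
      f i (x (k + 1) i) - ⟪y (k + 1) i, ξ - x (k + 1) i⟫ ≤ f i ξ := fun k i ξ hξ => by
    have heq : ∀ ζ : EuclideanSpace ℝ (Fin p), y k i + η⁻¹ • (ζ - d i + S (v k) i - ρ • W (y k) i)
        = (y k i + η⁻¹ • (-d i + S (v k) i - ρ • W (y k) i)) + η⁻¹ • ζ := fun ζ => by module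
    refine ConvexOn.le_of_minimizes_add_sq (hXconv i) (hfconv i) hη
      (c := y k i + η⁻¹ • (-d i + S (v k) i - ρ • W (y k) i)) (hxX k i) ?_ (fun ζ hζ => ?_) hξ
    · rw [← heq, hy k]
      rfl
    · rw [← heq, ← heq]
      exact hstep k i ζ hζ
  have hsum : ∀ k, ∀ x' : Fin n → EuclideanSpace ℝ (Fin p), (∀ i, x' i ∈ X i) →
      ∑ i, f i (x (k + 1) i) - B (y (k + 1)) (x' - x (k + 1)) ≤ ∑ i, f i (x' i) :=
    fun k x' hx' => by
      rw [tupleInner_apply, ← Finset.sum_sub_distrib]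
      exact Finset.sum_le_sum fun i _ => hsub k i _ (hx' i)
  have hmonostar : ∀ k, B (x (k + 1) - xstar) (y (k + 1) - ystar) ≤ 0 := fun k => by
    have h₁ := hsaddle (x (k + 1)) (hxX k)
    have h₂ := hsum k xstar hxstarX
    have h₃ : ∑ i, ⟪ystar i, x (k + 1) i - xstar i⟫ = B ystar (x (k + 1) - xstar) :=
      (tupleInner_apply _ _).symm
    rw [← neg_sub (x (k + 1)), map_neg] at h₂
    rw [tupleInner_comm, LinearMap.map_sub₂]
    linarith
  have hmonox : ∀ k, B (x (k + 2) - x (k + 1)) (y (k + 2) - y (k + 1)) ≤ 0 := fun k => by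
    have h₁ := hsum k (x (k + 2)) (hxX (k + 1))
    have h₂ := hsum (k + 1) (x (k + 1)) (hxX k)
    rw [← neg_sub (x (k + 1 + 1)), map_neg] at h₂
    rw [tupleInner_comm, LinearMap.map_sub₂]
    linarith
  have hSystar : S ystar = 0 := by rw [hystar, tupleMul_const hMrow]
  have hSy : ∀ k, S (y (k + 1)) = -((1 / ρ) • (v (k + 1) - v k)) := fun k => by
    rw [hv k, sub_sub_cancel_left, smul_neg, neg_neg, smul_smul, one_div_mul_cancel hρ.ne',
      one_smul]
  have hrate := Q.succ_mul_residual_le (fun a b => by rw [hQ, hQ, hPsymm, tupleInner_comm])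
    (fun a => by
      rw [hQ]
      exact add_nonneg (hPnonneg _) (mul_nonneg (by positivity) (tupleInner_self_nonneg _)))
    (fun k => (y k, v k)) (ystar, vstar)
    (fun k => by
      have hO : O (y (k + 1) - y k) = (x (k + 1) - xstar) + S (v (k + 1) - vstar) := by
        rw [hOy, map_sub, hvstar]
        abel
      have h := hmonostar k
      rw [hQ, hPsymm, LinearMap.compl₂_apply, tupleInner_comm]
      simp only [Prod.fst_sub, Prod.snd_sub]
      rw [hO, map_add, LinearMap.add_apply, tupleInner_tupleMul hMsymm, map_sub S, hSystar,
        sub_zero, hSy, map_neg, map_smul, smul_eq_mul, tupleInner_comm (v (k + 1) - v k)]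
      linarith)
    (fun k => by
      have hO : O ((y (k + 2) - y (k + 1)) - (y (k + 1) - y k))
          = (x (k + 2) - x (k + 1)) + S (v (k + 2) - v (k + 1)) := by
        rw [map_sub, hOy, hOy, map_sub]
        abel
      have hSdiff : S (y (k + 2) - y (k + 1))
          = -((1 / ρ) • ((v (k + 2) - v (k + 1)) - (v (k + 1) - v k))) := by
        rw [map_sub, hSy, hSy]
        module
      have h := hmonox k
      rw [hQ, hPsymm, LinearMap.compl₂_apply, tupleInner_comm]
      simp only [Prod.fst_sub, Prod.snd_sub]
      rw [hO, map_add, LinearMap.add_apply, tupleInner_tupleMul hMsymm, hSdiff, map_neg, map_smul,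
        smul_eq_mul, tupleInner_comm (v (k + 2) - v (k + 1) - _)]
      linarith) k
  have hQ₀ : Q ((y 0, v 0) - (ystar, vstar)) ((y 0, v 0) - (ystar, vstar)) = V₀ := by
    rw [hQ, hV₀, LinearMap.compl₂_apply, tupleInner_apply, tupleInner_self]
    rfl
  have hviolation : ∑ i, (x (k + 1) i - d i) = η • ∑ i, (y (k + 1) - y k) i := by
    have h := congrArg (fun u : Fin n → EuclideanSpace ℝ (Fin p) => ∑ i, u i) (hOy k)
    simp only [hΩdef, Pi.sub_apply, Pi.add_apply, Pi.smul_apply, Finset.sum_sub_distrib,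
      Finset.sum_add_distrib, ← Finset.smul_sum] at h ⊢
    rw [sum_tupleMul hLsymm hLrow, sum_tupleMul hMsymm hMrow, smul_zero, sub_zero, add_zero] at h
    exact h.symm
  have hcs := mul_norm_sum_sq_le _ hPsymm hPnonneg hPconst (y (k + 1) - y k)
  rw [Fintype.card_fin] at hcs
  rw [hQ₀, hQ] at hrate
  have hk₀ : (0 : ℝ) < k := by exact_mod_cast hk
  have hres : B.compl₂ O (y (k + 1) - y k) (y (k + 1) - y k) ≤ V₀ / k := by
    rw [le_div_iff₀ hk₀]
    have h₁ := hPnonneg (y (k + 1) - y k)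
    have h₂ : 0 ≤ (1 / ρ) * B (v (k + 1) - v k) (v (k + 1) - v k) :=
      mul_nonneg (by positivity) (tupleInner_self_nonneg _)
    simp only [Prod.fst_sub, Prod.snd_sub] at hrate
    linarith [mul_nonneg hk₀.le h₂]
  rw [← Real.sqrt_mul (by positivity), hviolation]
  refine Real.le_sqrt_of_sq_le ?_
  rw [norm_smul, Real.norm_of_nonneg hη.le]
  calc (η * ‖∑ i, (y (k + 1) - y k) i‖) ^ 2
      = η * (η * ‖∑ i, (y (k + 1) - y k) i‖ ^ 2) := by ring
    _ ≤ η * (n * (V₀ / k)) := mul_le_mul_of_nonneg_left (hcs.trans (by gcongr)) hη.le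
    _ = n * η * (V₀ / k) := by ring
end
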